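/- arXiv:0812.2780 — 7 statements merged into one kernel-verified Lean document; each statement's English description precedes it below -/
import Mathlib

section
/- Let V be a real vector space and I : V → V an ℝ-linear complex structure (I ∘ I = −id). For an alternating ℝ-bilinear map B : V × V → V define (𝓛_I B)(X,Y) = B(IX,IY) − I(B(IX,Y)) − I(B(X,IY)). Then 𝓛_I satisfies the quadratic relation 𝓛_I ∘ 𝓛_I + 2·𝓛_I − 3·id = 0 on the space of alternating bilinear V-valued maps; in particular the only possible eigenvalues of 𝓛_I are +1 and −3. -/
/-- The operator `𝓛_I = I_{(12)} + I_{(13)} + I_{(23)}` on `V`-valued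
alternating bilinear maps, given by
`(𝓛_I B)(X,Y) = B(IX,IY) − I(B(IX,Y)) − I(B(X,IY))`. -/
def twistL {V : Type*} [AddCommGroup V] [Module ℝ V] (I : V →ₗ[ℝ] V)
    (B : V → V → V) : V → V → V :=
  fun X Y => B (I X) (I Y) - I (B (I X) Y) - I (B X (I Y))

/-- `𝓛_I` satisfies `𝓛_I ∘ 𝓛_I + 2𝓛_I − 3·id = 0` on alternating bilinear
`V`-valued maps, so its only possible eigenvalues are `+1` and `−3`. -/
theorem stmt0 {V : Type*} [AddCommGroup V] [Module ℝ V]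
    (I : V →ₗ[ℝ] V) (hI : ∀ v, I (I v) = -v)
    (B : V →ₗ[ℝ] V →ₗ[ℝ] V) (hB : ∀ X Y, B X Y = - B Y X) :
    ∀ X Y : V,
      twistL I (twistL I (fun X Y => B X Y)) X Y
        + 2 • twistL I (fun X Y => B X Y) X Y - 3 • B X Y = 0 := by
  intro X Y
  simp only [twistL, map_sub, hI, map_neg, LinearMap.neg_apply, neg_neg]
  module
end

section
/- Let V be a real vector space with complex structure I (I ∘ I = −id). Let s, r be natural numbers with 2s ≤ r, and let X_1, …, X_r ∈ V satisfy: (i) IX_{2j−1} = X_{2j} for 1 ≤ j ≤ s, and (ii) the vectors X_1, …, X_r, IX_{2s+1}, …, IX_r are linearly independent. Let F_1, …, F_r be alternating bilinear forms on V and set G_k = F_k − I·F_k, where (I·F)(Y,Z) = F(IY,IZ). Then Σ_{k=1}^r (1 − 𝓛_I)(X_k ⊗ F_k) = 0 if and only if: (a) G_{2j−1}(Y,Z) = G_{2j}(IY,Z) for all Y,Z ∈ V and every 1 ≤ j ≤ s, and (b) G_k = 0 (i.e. F_k is of type (1,1)) for every 2s < k ≤ r. -/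
/-- Coefficients obtained from `∑ (g k • X k + h k • I (X k))` by pairing each odd index
`k` with `k + 1`, when `I (X k) = X (k + 1)`. -/
def pairedCoeff (g h : ℕ → ℝ) (k : ℕ) : ℝ :=
  if k % 2 = 1 then g k - h (k + 1) else g k + h (k - 1)

theorem sum_range_eq_sum_pairedCoeff {V : Type*} [AddCommGroup V] [Module ℝ V]
    (I : V →ₗ[ℝ] V) (hI : ∀ v, I (I v) = -v) (X : ℕ → V) (g h : ℕ → ℝ) (s : ℕ)
    (hX : ∀ j, 1 ≤ j → j ≤ s → I (X (2 * j - 1)) = X (2 * j)) :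
    ∑ k ∈ Finset.range (2 * s), (g (k + 1) • X (k + 1) + h (k + 1) • I (X (k + 1)))
      = ∑ k ∈ Finset.range (2 * s), pairedCoeff g h (k + 1) • X (k + 1) := by
  induction s with
  | zero => simp
  | succ n ih =>
    have h1 : I (X (2 * n + 1)) = X (2 * n + 2) := hX (n + 1) (by omega) le_rfl
    have h2 : I (X (2 * n + 2)) = -X (2 * n + 1) := by rw [← h1, hI]
    have hodd : pairedCoeff g h (2 * n + 1) = g (2 * n + 1) - h (2 * n + 2) := by
      rw [pairedCoeff, if_pos (by omega)]
    have heven : pairedCoeff g h (2 * n + 2) = g (2 * n + 2) + h (2 * n + 1) := by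
      rw [pairedCoeff, if_neg (by omega)]
      rfl
    rw [show 2 * (n + 1) = 2 * n + 1 + 1 by ring]
    simp only [Finset.sum_range_succ]
    rw [ih fun j hj hjn => hX j hj (by omega)]
    simp only [add_assoc, Nat.reduceAdd] at *
    rw [h1, h2, hodd, heven]
    module

theorem sum_Icc_eq_sum_pairedCoeff {V : Type*} [AddCommGroup V] [Module ℝ V]
    (I : V →ₗ[ℝ] V) (hI : ∀ v, I (I v) = -v) (X : ℕ → V) (g h : ℕ → ℝ) (s t : ℕ)
    (hX : ∀ j, 1 ≤ j → j ≤ s → I (X (2 * j - 1)) = X (2 * j)) :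
    ∑ k ∈ Finset.Icc 1 (2 * s + t), (g k • X k + h k • I (X k))
      = ∑ i : Fin (2 * s + t),
          (if (i : ℕ) < 2 * s then pairedCoeff g h (i + 1) else g (i + 1)) • X (i + 1)
        + ∑ i : Fin t, h (2 * s + i + 1) • I (X (2 * s + i + 1)) := by
  rw [Fin.sum_univ_eq_sum_range
      (fun i => (if i < 2 * s then pairedCoeff g h (i + 1) else g (i + 1)) • X (i + 1)),
    Fin.sum_univ_eq_sum_range (fun i => h (2 * s + i + 1) • I (X (2 * s + i + 1))),
    Finset.range_eq_Ico, ← Finset.Ico_add_one_right_eq_Icc, ← zero_add 1,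
    ← Finset.sum_Ico_add' (fun k => g k • X k + h k • I (X k)), ← Finset.range_eq_Ico,
    Finset.sum_range_add, Finset.sum_range_add]
  simp only [zero_add]
  rw [sum_range_eq_sum_pairedCoeff I hI X g h s hX, add_assoc,
    ← Finset.sum_add_distrib]
  congr 1
  · refine Finset.sum_congr rfl fun i hi => ?_
    rw [if_pos (Finset.mem_range.mp hi)]
  · refine Finset.sum_congr rfl fun i _ => ?_
    rw [if_neg (by omega)]

/-- Pointwise integrability criterion for twists: with vectors
`X_1, …, X_r` such that `IX_{2j−1} = X_{2j}` for `j ≤ s` and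
`X_1, …, X_r, IX_{2s+1}, …, IX_r` linearly independent, and alternating
bilinear forms `F_1, …, F_r` with `G_k = F_k − I·F_k`, the sum
`Σ_{k=1}^r (1 − 𝓛_I)(X_k ⊗ F_k)` vanishes if and only if
`G_{2j−1}(Y,Z) = G_{2j}(IY,Z)` for all `Y, Z` and `1 ≤ j ≤ s`, and
`G_k = 0` (i.e. `F_k` is of type `(1,1)`) for `2s < k ≤ r`. -/
theorem stmt3 {V : Type*} [AddCommGroup V] [Module ℝ V]
    (I : V →ₗ[ℝ] V) (hI : ∀ v, I (I v) = -v)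
    (s r : ℕ) (hsr : 2 * s ≤ r)
    (X : ℕ → V)
    (hX1 : ∀ j, 1 ≤ j → j ≤ s → I (X (2 * j - 1)) = X (2 * j))
    (hX2 : LinearIndependent ℝ
      (Sum.elim (fun i : Fin r => X ((i : ℕ) + 1))
        (fun i : Fin (r - 2 * s) => I (X (2 * s + (i : ℕ) + 1)))))
    (F : ℕ → V →ₗ[ℝ] V →ₗ[ℝ] ℝ)
    (hF : ∀ k Y Z, F k Y Z = - F k Z Y) :
    (∀ Y Z : V, ∑ k ∈ Finset.Icc 1 r,
        (F k Y Z • X k - twistL I (fun Y Z => F k Y Z • X k) Y Z) = 0)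
      ↔ ((∀ j, 1 ≤ j → j ≤ s → ∀ Y Z : V,
            F (2 * j - 1) Y Z - F (2 * j - 1) (I Y) (I Z)
              = F (2 * j) (I Y) Z - F (2 * j) (I (I Y)) (I Z))
          ∧ (∀ k, 2 * s < k → k ≤ r → ∀ Y Z : V,
            F k Y Z - F k (I Y) (I Z) = 0)) := by
  obtain ⟨t, rfl⟩ := Nat.exists_eq_add_of_le hsr
  rw [Nat.add_sub_cancel_left] at hX2
  have key : ∀ Y Z : V, ∑ k ∈ Finset.Icc 1 (2 * s + t),
      (F k Y Z • X k - twistL I (fun Y Z => F k Y Z • X k) Y Z)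
      = ∑ k ∈ Finset.Icc 1 (2 * s + t),
        ((F k Y Z - F k (I Y) (I Z)) • X k
          + (F k (I Y) Z - F k (I (I Y)) (I Z)) • I (X k)) := by
    intro Y Z
    refine Finset.sum_congr rfl fun k _ => ?_
    simp only [twistL, hI, map_neg, map_smul, LinearMap.neg_apply]
    module
  constructor
  · intro H
    have hcoeff : ∀ Y Z : V, _ := fun Y Z =>
      Fintype.linearIndependent_iff.mp hX2
        (Sum.elim
          (fun i : Fin (2 * s + t) => if (i : ℕ) < 2 * s then
            pairedCoeff (fun k => F k Y Z - F k (I Y) (I Z))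
              (fun k => F k (I Y) Z - F k (I (I Y)) (I Z)) (i + 1)
            else F (i + 1) Y Z - F (i + 1) (I Y) (I Z))
          (fun i : Fin t => F (2 * s + i + 1) (I Y) Z
            - F (2 * s + i + 1) (I (I Y)) (I Z)))
        (by
          rw [Fintype.sum_sum_type]
          simp only [Sum.elim_inl, Sum.elim_inr]
          rw [← H Y Z, key]
          exact (sum_Icc_eq_sum_pairedCoeff I hI X (fun k => F k Y Z - F k (I Y) (I Z))
            (fun k => F k (I Y) Z - F k (I (I Y)) (I Z)) s t hX1).symm)
    refine ⟨fun j hj hjs Y Z => ?_, fun k hk hkr Y Z => ?_⟩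
    · obtain ⟨n, rfl⟩ := Nat.exists_eq_add_of_le' hj
      have h := hcoeff Y Z (Sum.inl ⟨2 * n, by omega⟩)
      simp only [Sum.elim_inl] at h
      rw [if_pos (by omega), pairedCoeff, if_pos (by omega)] at h
      exact sub_eq_zero.mp h
    · obtain ⟨n, rfl⟩ := Nat.exists_eq_add_of_le' (show 1 ≤ k by omega)
      have h := hcoeff Y Z (Sum.inl ⟨n, by omega⟩)
      simp only [Sum.elim_inl] at h
      rwa [if_neg (by omega)] at h
  · rintro ⟨ha, hb⟩ Y Z
    rw [key, sum_Icc_eq_sum_pairedCoeff I hI X (fun k => F k Y Z - F k (I Y) (I Z))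
      (fun k => F k (I Y) Z - F k (I (I Y)) (I Z)) s t hX1]
    have h1 : ∀ i : Fin (2 * s + t), (if (i : ℕ) < 2 * s then
        pairedCoeff (fun k => F k Y Z - F k (I Y) (I Z))
          (fun k => F k (I Y) Z - F k (I (I Y)) (I Z)) (i + 1)
        else F (i + 1) Y Z - F (i + 1) (I Y) (I Z)) = 0 := by
      rintro ⟨i, hi⟩
      dsimp only
      split_ifs with his
      · rcases Nat.even_or_odd' i with ⟨n, rfl | rfl⟩
        · rw [pairedCoeff, if_pos (by omega)]
          exact sub_eq_zero.mpr (ha (n + 1) (by omega) (by omega) Y Z)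
        · rw [pairedCoeff, if_neg (by omega)]
          have h := ha (n + 1) (by omega) (by omega) (I Y) Z
          rw [show 2 * (n + 1) - 1 = 2 * n + 1 by omega,
            show 2 * (n + 1) = 2 * n + 1 + 1 by ring] at h
          simp only [hI, map_neg, LinearMap.neg_apply, Nat.add_sub_cancel] at h ⊢
          linarith
      · exact hb (i + 1) (by omega) (by omega) Y Z
    have h2 : ∀ i : Fin t, F (2 * s + i + 1) (I Y) Z
        - F (2 * s + i + 1) (I (I Y)) (I Z) = 0 :=
      fun i => hb _ (by omega) (by omega) (I Y) Z
    simp only [h1, h2, zero_smul, Finset.sum_const_zero, add_zero]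
end

section
/- Let g : ℍ × ℍ → ℝ be a symmetric ℝ-bilinear form on the quaternions that is invariant under left multiplication by i, j and k: g(ix, iy) = g(x,y), g(jx, jy) = g(x,y) and g(kx, ky) = g(x,y) for all x, y ∈ ℍ. Then g(x,y) = g(1,1) · Re(x · conj(y)) for all x, y ∈ ℍ; that is, every hyperHermitian symmetric bilinear form on the four-dimensional quaternionic vector space ℍ is proportional to the standard inner product ⟨x,y⟩ = Re(x · conj(y)). -/
/-- The quaternion `i`. -/
def quatI : Quaternion ℝ := ⟨0, 1, 0, 0⟩
/-- The quaternion `j`. -/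
def quatJ : Quaternion ℝ := ⟨0, 0, 1, 0⟩
/-- The quaternion `k`. -/
def quatK : Quaternion ℝ := ⟨0, 0, 0, 1⟩

@[simp] theorem quatI_re : quatI.re = 0 := rfl
@[simp] theorem quatI_imI : quatI.imI = 1 := rfl
@[simp] theorem quatI_imJ : quatI.imJ = 0 := rfl
@[simp] theorem quatI_imK : quatI.imK = 0 := rfl
@[simp] theorem quatJ_re : quatJ.re = 0 := rfl
@[simp] theorem quatJ_imI : quatJ.imI = 0 := rfl
@[simp] theorem quatJ_imJ : quatJ.imJ = 1 := rfl
@[simp] theorem quatJ_imK : quatJ.imK = 0 := rfl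
@[simp] theorem quatK_re : quatK.re = 0 := rfl
@[simp] theorem quatK_imI : quatK.imI = 0 := rfl
@[simp] theorem quatK_imJ : quatK.imJ = 0 := rfl
@[simp] theorem quatK_imK : quatK.imK = 1 := rfl

section

open scoped Quaternion

theorem apply_mul_self_eq_zero_of_mul_self_eq_neg_one {A : Type*} [Ring A] [Algebra ℝ A]
    (g : A →ₗ[ℝ] A →ₗ[ℝ] ℝ) (hsymm : ∀ x y, g x y = g y x) {q : A} (hq : q * q = -1)
    (hinv : ∀ x y, g (q * x) (q * y) = g x y) (x : A) : g x (q * x) = 0 := by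
  have h := hinv x (q * x)
  rw [← mul_assoc, hq, neg_one_mul, map_neg, hsymm] at h
  linarith

theorem quatI_mul_quatI : quatI * quatI = -1 := by
  apply Quaternion.ext <;> simp

theorem quatJ_mul_quatJ : quatJ * quatJ = -1 := by
  apply Quaternion.ext <;> simp

theorem quatK_mul_quatK : quatK * quatK = -1 := by
  apply Quaternion.ext <;> simp

theorem quatI_mul_quatJ : quatI * quatJ = quatK := by
  apply Quaternion.ext <;> simp

theorem quatJ_mul_quatK : quatJ * quatK = quatI := by
  apply Quaternion.ext <;> simp

theorem quatK_mul_quatI : quatK * quatI = quatJ := by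
  apply Quaternion.ext <;> simp

theorem quaternion_eq_smul_add (x : Quaternion ℝ) :
    x = x.re • 1 + x.imI • quatI + x.imJ • quatJ + x.imK • quatK := by
  apply Quaternion.ext <;> simp

end

/-- Every symmetric bilinear form on the quaternions `ℍ` that is invariant
under left multiplication by `i`, `j` and `k` (i.e. hyperHermitian) is
proportional to the standard inner product `⟨x,y⟩ = Re(x · conj y)`, with
factor `g(1,1)`. -/
theorem stmt4 (g : Quaternion ℝ →ₗ[ℝ] Quaternion ℝ →ₗ[ℝ] ℝ)
    (hsymm : ∀ x y, g x y = g y x)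
    (hI : ∀ x y : Quaternion ℝ, g (quatI * x) (quatI * y) = g x y)
    (hJ : ∀ x y : Quaternion ℝ, g (quatJ * x) (quatJ * y) = g x y)
    (hK : ∀ x y : Quaternion ℝ, g (quatK * x) (quatK * y) = g x y) :
    ∀ x y : Quaternion ℝ, g x y = g 1 1 * (x * star y).re := by
  have zI := apply_mul_self_eq_zero_of_mul_self_eq_neg_one g hsymm quatI_mul_quatI hI
  have zJ := apply_mul_self_eq_zero_of_mul_self_eq_neg_one g hsymm quatJ_mul_quatJ hJ
  have zK := apply_mul_self_eq_zero_of_mul_self_eq_neg_one g hsymm quatK_mul_quatK hK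
  have h1I : g 1 quatI = 0 := by simpa using zI 1
  have h1J : g 1 quatJ = 0 := by simpa using zJ 1
  have h1K : g 1 quatK = 0 := by simpa using zK 1
  have hgIJ : g quatI quatJ = 0 := by simpa [quatK_mul_quatI] using zK quatI
  have hgJK : g quatJ quatK = 0 := by simpa [quatI_mul_quatJ] using zI quatJ
  have hgKI : g quatK quatI = 0 := by simpa [quatJ_mul_quatK] using zJ quatK
  have hgII : g quatI quatI = g 1 1 := by simpa using hI 1 1
  have hgJJ : g quatJ quatJ = g 1 1 := by simpa using hJ 1 1
  have hgKK : g quatK quatK = g 1 1 := by simpa using hK 1 1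
  intro x y
  have hre : (x * star y).re =
      x.re * y.re + x.imI * y.imI + x.imJ * y.imJ + x.imK * y.imK := by
    simp
  rw [hre]
  conv_lhs => rw [quaternion_eq_smul_add x, quaternion_eq_smul_add y]
  simp only [map_add, map_smul, LinearMap.add_apply, LinearMap.smul_apply, smul_eq_mul,
    h1I, h1J, h1K, hgIJ, hgJK, hgKI, hgII, hgJJ, hgKK, hsymm quatI 1, hsymm quatJ 1,
    hsymm quatK 1, hsymm quatJ quatI, hsymm quatK quatJ, hsymm quatI quatK]
  ring
end

section
/- Let V = ℍ ⊕ ℍ with complex structures I, J, K acting diagonally by left multiplication by i, j, k. Define 2-forms Ω_A on V by Ω_A((x,u),(y,v)) = Re((a·x)·conj(y)) for a = i, j, k, let F_0 be any alternating bilinear form on V that vanishes whenever one argument lies in 0 ⊕ ℍ and satisfies F_0(Az, Aw) = F_0(z,w) for A = I, J, K, and let b_0, b_1, b_2, b_3 ∈ V* be the linear forms vanishing on the first summand and restricting on the second summand to the basis dual to 1, i, j, k. Then, with (A·F)(z,w) = F(Az, Aw), the two 3-forms Σ_{a=0}^{3} (I·F_a) ∧ b_a and Σ_{a=0}^{3}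 (J·F_a) ∧ b_a, where (F_0, F_1, F_2, F_3) = (F_0, Ω_I, Ω_J, Ω_K), are distinct; explicitly, F_0 ∧ b_0 + Ω_I ∧ b_1 − Ω_J ∧ b_2 − Ω_K ∧ b_3 ≠ F_0 ∧ b_0 − Ω_I ∧ b_1 + Ω_J ∧ b_2 − Ω_K ∧ b_3. -/
noncomputable section

/-- `V = ℍ ⊕ ℍ`. -/
abbrev VH := Quaternion ℝ × Quaternion ℝ

/-- Diagonal left multiplication by a quaternion `a` on `V = ℍ ⊕ ℍ`;
for `a = i, j, k` these are the complex structures `I, J, K`. -/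
def mulA (a : Quaternion ℝ) : VH → VH := fun z => (a * z.1, a * z.2)

/-- The 2-forms `Ω_A((x,u),(y,v)) = Re((a·x)·conj y)` on `V = ℍ ⊕ ℍ`. -/
def OmV (a : Quaternion ℝ) : VH → VH → ℝ := fun z w => ((a * z.1) * star w.1).re

/-- The 1-forms `b_0, b_1, b_2, b_3` on `V = ℍ ⊕ ℍ` vanishing on the first
summand and dual on the second summand to the basis `1, i, j, k`. -/
def bb0 : VH → ℝ := fun z => z.2.re
def bb1 : VH → ℝ := fun z => z.2.imI
def bb2 : VH → ℝ := fun z => z.2.imJ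
def bb3 : VH → ℝ := fun z => z.2.imK

/-- Wedge product of a 2-form and a 1-form on `V`. -/
def w21 (F : VH → VH → ℝ) (b : VH → ℝ) : VH → VH → VH → ℝ :=
  fun x y z => F x y * b z - F x z * b y + F y z * b x

/-- The action `(A·F)(z,w) = F(Az, Aw)` on 2-forms. -/
def pull (A : VH → VH) (F : VH → VH → ℝ) : VH → VH → ℝ := fun z w => F (A z) (A w)

/-- For the twisting data `(F_0, F_1, F_2, F_3) = (F_0, Ω_I, Ω_J, Ω_K)` on
`V = ℍ ⊕ ℍ`, the two 3-forms `Σ_a (I·F_a) ∧ b_a` and `Σ_a (J·F_a) ∧ b_a`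
are distinct; explicitly,
`F_0∧b_0 + Ω_I∧b_1 − Ω_J∧b_2 − Ω_K∧b_3 ≠ F_0∧b_0 − Ω_I∧b_1 + Ω_J∧b_2 − Ω_K∧b_3`. -/
theorem stmt10 (F0 : VH →ₗ[ℝ] VH →ₗ[ℝ] ℝ)
    (halt : ∀ z w : VH, F0 z w = - F0 w z)
    (hvan : ∀ z w : VH, (z.1 = 0 → F0 z w = 0) ∧ (w.1 = 0 → F0 z w = 0))
    (hinv : ∀ a ∈ ({quatI, quatJ, quatK} : Set (Quaternion ℝ)),
      ∀ z w : VH, F0 (mulA a z) (mulA a w) = F0 z w) :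
    (fun x y z =>
        w21 (pull (mulA quatI) (fun z w => F0 z w)) bb0 x y z
          + w21 (pull (mulA quatI) (OmV quatI)) bb1 x y z
          + w21 (pull (mulA quatI) (OmV quatJ)) bb2 x y z
          + w21 (pull (mulA quatI) (OmV quatK)) bb3 x y z)
      ≠ (fun x y z =>
        w21 (pull (mulA quatJ) (fun z w => F0 z w)) bb0 x y z
          + w21 (pull (mulA quatJ) (OmV quatI)) bb1 x y z
          + w21 (pull (mulA quatJ) (OmV quatJ)) bb2 x y z
          + w21 (pull (mulA quatJ) (OmV quatK)) bb3 x y z) ∧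
    (fun x y z =>
        w21 (fun z w => F0 z w) bb0 x y z + w21 (OmV quatI) bb1 x y z
          - w21 (OmV quatJ) bb2 x y z - w21 (OmV quatK) bb3 x y z)
      ≠ (fun x y z =>
        w21 (fun z w => F0 z w) bb0 x y z - w21 (OmV quatI) bb1 x y z
          + w21 (OmV quatJ) bb2 x y z - w21 (OmV quatK) bb3 x y z) := by
  refine ⟨fun h => ?_, fun h => ?_⟩ <;>
  · have h' := congrFun (congrFun (congrFun h (1, 0)) (quatI, 0)) (0, quatI)
    simp only [w21, pull, mulA, OmV, bb0, bb1, bb2, bb3, Quaternion.re_mul,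
      Quaternion.imI_mul, Quaternion.imJ_mul, Quaternion.imK_mul, Quaternion.re_star,
      Quaternion.imI_star, Quaternion.imJ_star, Quaternion.imK_star, Quaternion.re_zero,
      Quaternion.imI_zero, Quaternion.imJ_zero, Quaternion.imK_zero, Quaternion.re_one,
      Quaternion.imI_one, Quaternion.imJ_one, Quaternion.imK_one] at h'
    norm_num [quatI, quatJ, quatK] at h'

end
end

section
/- Let V be a finite-dimensional complex vector space of complex dimension m, let Θ : V^m → ℂ be a ℂ-multilinear alternating m-form, and let F : V × V → ℝ be an ℝ-bilinear alternating form of type (1,1), i.e. F(i·x, i·y) = F(x,y) for all x, y ∈ V. Regarding F as ℂ-valued via ℝ ⊆ ℂ and Θ as an ℝ-multilinear alternating ℂ-valued m-form, the exterior product F ∧ Θ, an ℝ-multilinear alternating ℂ-valued (m+2)-form on V, is identically zero. -/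
/-- The exterior (wedge) product over `ℝ` of a `ℂ`-valued alternating `p`-form
and a `ℂ`-valued alternating `q`-form on a real vector space `V`, given by the
standard antisymmetrisation formula
`(F ∧ G)(v) = (1/(p! q!)) Σ_σ sign(σ) F(v∘σ|_{first p}) G(v∘σ|_{last q})`. -/
noncomputable def rwedge {V : Type*} {p q : ℕ}
    (F : (Fin p → V) → ℂ) (G : (Fin q → V) → ℂ) : (Fin (p + q) → V) → ℂ :=
  fun v => ((p.factorial * q.factorial : ℕ) : ℂ)⁻¹ *
    ∑ σ : Equiv.Perm (Fin (p + q)),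
      ((Equiv.Perm.sign σ : ℤ) : ℂ) *
        F (fun i => v (σ (Fin.castAdd q i))) * G (fun i => v (σ (Fin.natAdd p i)))

open Equiv Finset in
/-- The antisymmetrisation of `g ⊗ Θ`, with `g` a linear form and `Θ` an alternating form of top
degree, vanishes. -/
theorem sum_sign_mul_dual_mul_alternating_eq_zero {K V : Type*} [Field K] [AddCommGroup V]
    [Module K V] [FiniteDimensional K V] {m : ℕ} (hm : Module.finrank K V = m)
    (g : Module.Dual K V) (Θ : V [⋀^Fin m]→ₗ[K] K) (u : Unit ⊕ Fin m → V) :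
    ∑ τ : Perm (Unit ⊕ Fin m), ((Perm.sign τ : ℤ) : K) *
      (g (u (τ (.inl ()))) * Θ fun i => u (τ (.inr i))) = 0 := by
  let f : MultilinearMap K (fun _ : Unit ⊕ Fin m => V) K :=
    (LinearMap.mul' K K).compMultilinearMap
      ((MultilinearMap.ofSubsingleton K V K () g).domCoprod Θ.toMultilinearMap)
  have hdep : ¬LinearIndependent K u := fun h => by
    have := h.fintype_card_le_finrank
    simp [hm] at this
  have h := f.alternatization.map_linearDependent u hdep
  rw [MultilinearMap.alternatization_apply] at h
  simpa [f, Units.smul_def, zsmul_eq_mul] using h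

open Equiv Finset in
/-- The antisymmetrisation of `h ⊗ Θ` vanishes when `Θ` is an alternating form of top degree and
`h` is linear in one of its two arguments; the other one is put in slot `b`. -/
theorem sum_sign_mul_semibilinear_mul_alternating_eq_zero {K V α : Type*} [Field K] [CharZero K]
    [AddCommGroup V] [Module K V] [FiniteDimensional K V] [Fintype α] [DecidableEq α] {m : ℕ}
    (hm : Module.finrank K V = m) (h : V → Module.Dual K V) (Θ : V [⋀^Fin m]→ₗ[K] K)
    (e : Unit ⊕ Fin m ↪ α) {b : α} (hb : b ∉ Set.range e) (v : α → V) :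
    ∑ σ : Perm α, ((Perm.sign σ : ℤ) : K) *
      (h (v (σ b)) (v (σ (e (.inl ())))) * Θ fun i => v (σ (e (.inr i)))) = 0 := by
  classical
  set S := ∑ σ : Perm α, ((Perm.sign σ : ℤ) : K) *
      (h (v (σ b)) (v (σ (e (.inl ())))) * Θ fun i => v (σ (e (.inr i)))) with hS
  have key (τ : Perm (Unit ⊕ Fin m)) : S = ∑ σ : Perm α, ((Perm.sign σ : ℤ) : K) *
      (((Perm.sign τ : ℤ) : K) * (h (v (σ b)) (v (σ (e (τ (.inl ()))))) *
        Θ fun i => v (σ (e (τ (.inr i)))))) := by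
    have hsign : Perm.sign (τ.viaEmbedding e) = Perm.sign τ := by
      unfold Perm.viaEmbedding
      convert Perm.sign_extendDomain τ (Equiv.ofInjective e.1 e.2)
    rw [hS, ← Equiv.sum_comp (Equiv.mulRight (τ.viaEmbedding e))]
    refine sum_congr rfl fun σ _ => ?_
    simp [Perm.viaEmbedding_apply, Perm.viaEmbedding_apply_of_notMem τ e b hb, hsign, mul_assoc]
  have hsum : ∑ _τ : Perm (Unit ⊕ Fin m), S = 0 := by
    rw [sum_congr rfl fun τ _ => key τ, sum_comm]
    refine sum_eq_zero fun σ _ => ?_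
    rw [← mul_sum, sum_sign_mul_dual_mul_alternating_eq_zero hm (h (v (σ b))) Θ fun x => v (σ (e x)),
      mul_zero]
  simpa [Fintype.card_ne_zero] using hsum

/-- A real alternating form `F` of type `(1,1)` is half the antisymmetrisation of
`F(x, y) - i F(ix, y)`, which is complex linear in `x`. -/
theorem two_mul_eq_extendRCLike_sub_extendRCLike {V : Type*} [AddCommGroup V] [Module ℂ V]
    (F : V →ₗ[ℝ] V →ₗ[ℝ] ℝ) (halt : ∀ x y : V, F x y = - F y x)
    (h11 : ∀ x y : V, F (Complex.I • x) (Complex.I • y) = F x y) (x y : V) :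
    2 * (F x y : ℂ) = Module.Dual.extendRCLike (𝕜 := ℂ) (F.flip y) x -
      Module.Dual.extendRCLike (𝕜 := ℂ) (F.flip x) y := by
  have hI : F (Complex.I • y) x = F (Complex.I • x) y := by
    rw [halt, ← h11 x, smul_smul, Complex.I_mul_I]
    simp
  simp only [Module.Dual.extendRCLike_apply, LinearMap.flip_apply, RCLike.I_to_complex,
    RCLike.ofReal_eq_complex_ofReal, hI, halt y x]
  push_cast
  ring

/-- On a complex vector space of complex dimension `m`, the wedge product
`F ∧ Θ` of a real alternating bilinear form `F` of type `(1,1)` with a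
`ℂ`-multilinear alternating `m`-form `Θ` vanishes identically. -/
theorem stmt12 {V : Type*} [AddCommGroup V] [Module ℂ V] [FiniteDimensional ℂ V]
    {m : ℕ} (hm : Module.finrank ℂ V = m)
    (Θ : AlternatingMap ℂ V ℂ (Fin m))
    (F : V →ₗ[ℝ] V →ₗ[ℝ] ℝ) (halt : ∀ x y : V, F x y = - F y x)
    (h11 : ∀ x y : V, F ((Complex.I : ℂ) • x) ((Complex.I : ℂ) • y) = F x y) :
    rwedge (fun v : Fin 2 → V => ((F (v 0) (v 1) : ℝ) : ℂ)) (fun v : Fin m → V => Θ v) = 0 := by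
  funext v
  let h (y : V) : Module.Dual ℂ V := Module.Dual.extendRCLike (F.flip y)
  let e (a : Fin 2) : Unit ⊕ Fin m ↪ Fin (2 + m) :=
    ⟨Sum.elim (fun _ => Fin.castAdd m a) (Fin.natAdd 2), by
      rintro (_ | i) (_ | j) hij <;> simp [Fin.ext_iff] at hij ⊢ <;> omega⟩
  have he {a b : Fin 2} (hab : a ≠ b) : Fin.castAdd m b ∉ Set.range (e a) := by
    rintro ⟨_ | i, hi⟩
    · exact hab (Fin.castAdd_injective 2 m hi)
    · have := congrArg Fin.val (show Fin.natAdd 2 i = Fin.castAdd m b from hi)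
      simp at this
      omega
  have h₁ := sum_sign_mul_semibilinear_mul_alternating_eq_zero hm h Θ (e 0)
    (he (zero_ne_one (α := Fin 2))) v
  have h₂ := sum_sign_mul_semibilinear_mul_alternating_eq_zero hm h Θ (e 1)
    (he (one_ne_zero (α := Fin 2))) v
  have hsub := congrArg₂ (· - ·) h₁ h₂
  simp only [← Finset.sum_sub_distrib, sub_zero, ← mul_sub] at hsub
  refine mul_eq_zero_of_right _ (mul_left_cancel₀ (two_ne_zero (α := ℂ)) ?_)
  rw [mul_zero, ← hsub, Finset.mul_sum]
  refine Finset.sum_congr rfl fun σ _ => ?_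
  have hF := two_mul_eq_extendRCLike_sub_extendRCLike F halt h11
    (v (σ (Fin.castAdd m 0))) (v (σ (Fin.castAdd m 1)))
  change _ = _ * (h _ (v (σ (Fin.castAdd m 0))) * (Θ fun i => v (σ (Fin.natAdd 2 i))) -
    h _ (v (σ (Fin.castAdd m 1))) * (Θ fun i => v (σ (Fin.natAdd 2 i))))
  linear_combination ((Equiv.Perm.sign σ : ℤ) : ℂ) * (Θ fun i => v (σ (Fin.natAdd 2 i))) * hF
end

section
/- Let V be a finite-dimensional complex vector space of complex dimension m, and let Θ : V^m → ℂ be a nonzero ℂ-multilinear alternating m-form. If α : V → ℝ is an ℝ-linear form such that the exterior product α ∧ Θ (over ℝ, with α regarded as ℂ-valued and Θ as an ℝ-multilinear alternating ℂ-valued m-form) vanishes identically, then α = 0. -/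
/-- Alternating sums over permutations of `Fin (m + 1)`, indexed by the first value and a
permutation of the remaining indices. -/
theorem sum_perm_cons {V : Type*} [AddCommGroup V] [Module ℂ V] {m : ℕ}
    (Θ : AlternatingMap ℂ V ℂ (Fin m)) (a : V → ℂ) (u : V) (w : Fin m → V) :
    ∑ σ : Equiv.Perm (Fin (m + 1)), ((Equiv.Perm.sign σ : ℤ) : ℂ) *
        a ((Fin.cons u w : Fin (m + 1) → V) (σ 0)) *
        Θ (fun i => (Fin.cons u w : Fin (m + 1) → V) (σ i.succ)) =
      (m.factorial : ℂ) * (a u * Θ w) -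
        ∑ j : Fin m, ∑ τ : Equiv.Perm (Fin m), ((Equiv.Perm.sign τ : ℤ) : ℂ) * a (w j) *
          Θ (Function.update (w ∘ τ) (τ.symm j) u) := by
  rw [← Equiv.Perm.decomposeFin.symm.sum_comp, Fintype.sum_prod_type, Fin.sum_univ_succ,
    sub_eq_add_neg, ← Finset.sum_neg_distrib]
  congr 1
  · have key (τ : Equiv.Perm (Fin m)) :
        ((Equiv.Perm.sign τ : ℤ) : ℂ) * a u * Θ (fun i => w (τ i)) = a u * Θ w := by
      have hτ : Θ (fun i => w (τ i)) = ((Equiv.Perm.sign τ : ℤ) : ℂ) * Θ w := by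
        rw [show (fun i => w (τ i)) = w ∘ τ from rfl, Θ.map_perm, Units.smul_def, zsmul_eq_mul]
      have hsq : ((Equiv.Perm.sign τ : ℤ) : ℂ) * ((Equiv.Perm.sign τ : ℤ) : ℂ) = 1 := by
        rw [← Int.cast_mul, Int.units_coe_mul_self, Int.cast_one]
      rw [hτ]
      linear_combination (a u * Θ w) * hsq
    simp [key, Fintype.card_perm]
  · refine Finset.sum_congr rfl fun j _ => ?_
    rw [← Finset.sum_neg_distrib]
    refine Finset.sum_congr rfl fun τ _ => ?_
    have hupd : (fun i => (Fin.cons u w : Fin (m + 1) → V)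
        (Equiv.Perm.decomposeFin.symm (j.succ, τ) i.succ)) =
        Function.update (w ∘ τ) (τ.symm j) u := by
      funext i
      rw [Equiv.Perm.decomposeFin_symm_apply_succ]
      by_cases hi : i = τ.symm j
      · subst hi
        simp
      · have hij : τ i ≠ j := fun h => hi (by simp [← h])
        rw [Function.update_of_ne hi, Equiv.swap_apply_of_ne_of_ne (Fin.succ_ne_zero _)
          (fun h => hij (Fin.succ_injective _ h))]
        simp
    rw [hupd]
    simp [Equiv.Perm.decomposeFin.symm_sign]

/-- The wedge of a `1`-form with an alternating `m`-form, evaluated on `u` followed by `w`. -/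
theorem rwedge_cons {V : Type*} [AddCommGroup V] [Module ℂ V] {m : ℕ}
    (Θ : AlternatingMap ℂ V ℂ (Fin m)) (a : V → ℂ) (u : V) (w : Fin m → V) :
    (m.factorial : ℂ) * rwedge (fun v : Fin 1 → V => a (v 0)) (fun v : Fin m → V => Θ v)
        (fun i => (Fin.cons u w : Fin (m + 1) → V) (finCongr (Nat.add_comm 1 m) i)) =
      (m.factorial : ℂ) * (a u * Θ w) -
        ∑ j : Fin m, ∑ τ : Equiv.Perm (Fin m), ((Equiv.Perm.sign τ : ℤ) : ℂ) * a (w j) *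
          Θ (Function.update (w ∘ τ) (τ.symm j) u) := by
  rw [← sum_perm_cons]
  have hm : (m.factorial : ℂ) ≠ 0 := Nat.cast_ne_zero.mpr m.factorial_ne_zero
  simp only [rwedge, Nat.factorial_one, one_mul]
  rw [mul_inv_cancel_left₀ hm]
  refine Fintype.sum_equiv (finCongr (Nat.add_comm 1 m)).permCongr _ _ fun σ => ?_
  have h0 : (finCongr (Nat.add_comm 1 m)).symm 0 = Fin.castAdd m 0 := by
    ext; simp
  have hs (i : Fin m) : (finCongr (Nat.add_comm 1 m)).symm i.succ = Fin.natAdd 1 i := by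
    ext; simp [Nat.add_comm]
  simp only [Equiv.Perm.sign_permCongr, Equiv.permCongr_apply, h0, hs]

/-- On a complex vector space of complex dimension `m`, wedging with a nonzero
`ℂ`-multilinear alternating `m`-form `Θ` is injective on real 1-forms: if
`α ∧ Θ = 0` then `α = 0`. -/
theorem stmt13 {V : Type*} [AddCommGroup V] [Module ℂ V] [FiniteDimensional ℂ V]
    {m : ℕ} (hm : Module.finrank ℂ V = m)
    (Θ : AlternatingMap ℂ V ℂ (Fin m)) (hΘ : Θ ≠ 0)
    (α : V →ₗ[ℝ] ℝ)
    (h : rwedge (fun v : Fin 1 → V => ((α (v 0) : ℝ) : ℂ)) (fun v : Fin m → V => Θ v) = 0) :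
    α = 0 := by
  obtain ⟨w, hw⟩ : ∃ w, Θ w ≠ 0 := by
    by_contra! hc
    exact hΘ (AlternatingMap.ext hc)
  ext u
  have hu := rwedge_cons Θ (fun x => ((α x : ℝ) : ℂ)) u w
  have hIu := rwedge_cons Θ (fun x => ((α x : ℝ) : ℂ)) (Complex.I • u) w
  have hm : (m.factorial : ℂ) ≠ 0 := Nat.cast_ne_zero.mpr m.factorial_ne_zero
  rw [h] at hu hIu
  simp only [AlternatingMap.map_update_smul, smul_eq_mul, mul_left_comm _ Complex.I,
    ← Finset.mul_sum] at hIu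
  have hα : ((α (Complex.I • u) : ℝ) : ℂ) = Complex.I * ((α u : ℝ) : ℂ) := by
    apply mul_right_cancel₀ (mul_ne_zero hm hw)
    simp only [Pi.zero_apply, mul_zero] at hu hIu
    linear_combination Complex.I * hu - hIu
  simpa using (congrArg Complex.im hα).symm
end

section
/- Let V be a finite-dimensional complex vector space of complex dimension m, Θ : V^m → ℂ a ℂ-multilinear alternating m-form, and F : V × V → ℝ an ℝ-bilinear alternating form of type (1,1), i.e. F(i·x, i·y) = F(x,y). Then for every X ∈ V, (ι_X F) ∧ Θ + F ∧ (ι_X Θ) = 0, where ι_X denotes the interior product (contraction with X in the first argument), and the wedges are exterior products over ℝ of ℂ-valued alternating forms. -/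
/-- Exchange identity for a top-degree alternating form. -/
theorem AlternatingMap.map_smul_eq_sum_map_update {K V ι : Type*} [Field K] [AddCommGroup V]
    [Module K V] [FiniteDimensional K V] [Fintype ι] [DecidableEq ι]
    (hι : Module.finrank K V = Fintype.card ι) (Θ : V [⋀^ι]→ₗ[K] K) (L : V →ₗ[K] K)
    (w : ι → V) (x : V) :
    L x * Θ w = ∑ i, L (w i) * Θ (Function.update w i x) := by
  let b : Module.Basis ι K V := (Module.finBasis K V).reindex (Fintype.equivFinOfCardEq hι.symm).symm
  have key : b.det w • x = ∑ i, b.det (Function.update w i x) • w i := by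
    apply b.repr.injective
    ext j
    have h := congrFun (Matrix.mulVec_cramer (b.toMatrix w) (b.repr x)) j
    simp only [Matrix.mulVec, dotProduct, Matrix.cramer_apply, ← Module.Basis.toMatrix_update,
      ← Module.Basis.det_apply, Module.Basis.toMatrix_apply, Pi.smul_apply] at h
    simpa [mul_comm] using h.symm
  have hL := congrArg L key
  simp only [map_smul, map_sum, smul_eq_mul] at hL
  rw [Θ.eq_smul_basis_det b]
  simp only [AlternatingMap.smul_apply, smul_eq_mul]
  rw [mul_left_comm, mul_comm (L x), hL, Finset.mul_sum]
  exact Finset.sum_congr rfl fun i _ => by ring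

theorem Fin.sum_sign_mul_swap {n : ℕ} (f : Equiv.Perm (Fin n) → ℂ) {i j : Fin n} (hij : i ≠ j) :
    ∑ σ : Equiv.Perm (Fin n), ((Equiv.Perm.sign σ : ℤ) : ℂ) * f (σ * Equiv.swap i j) =
      -∑ σ : Equiv.Perm (Fin n), ((Equiv.Perm.sign σ : ℤ) : ℂ) * f σ := by
  rw [← Equiv.sum_comp (Equiv.mulRight (Equiv.swap i j)), ← Finset.sum_neg_distrib]
  refine Finset.sum_congr rfl fun σ _ => ?_
  simp [mul_assoc, Equiv.Perm.sign_swap hij]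

theorem rwedge_cast {V : Type*} {p q N : ℕ} (h : p + q = N) (G : (Fin p → V) → ℂ) (H : (Fin q → V) → ℂ)
    (v : Fin N → V) :
    rwedge G H (fun i => v (Fin.cast h i)) = ((p.factorial * q.factorial : ℕ) : ℂ)⁻¹ *
      ∑ σ : Equiv.Perm (Fin N), ((Equiv.Perm.sign σ : ℤ) : ℂ) *
        (G (fun i => v (σ (Fin.cast h (Fin.castAdd q i)))) *
          H (fun i => v (σ (Fin.cast h (Fin.natAdd p i))))) := by
  subst h
  simp only [rwedge, mul_assoc, Fin.cast_refl, id]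

section

variable {V : Type*} [AddCommGroup V] [Module ℂ V] {n : ℕ}

/-- A complex linear one-form wedged with a top-degree form vanishes. -/
theorem AlternatingMap.sum_sign_mul_linear_mul_eq_zero [FiniteDimensional ℂ V]
    (hm : Module.finrank ℂ V = n + 1) (Θ : V [⋀^Fin (n + 1)]→ₗ[ℂ] ℂ) (L : V →ₗ[ℂ] ℂ)
    (v : Fin (n + 2) → V) :
    ∑ σ : Equiv.Perm (Fin (n + 2)),
      ((Equiv.Perm.sign σ : ℤ) : ℂ) * (L (v (σ 0)) * Θ fun i => v (σ i.succ)) = 0 := by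
  set f : Equiv.Perm (Fin (n + 2)) → ℂ := fun σ => L (v (σ 0)) * Θ fun i => v (σ i.succ) with hf
  have hstep (σ : Equiv.Perm (Fin (n + 2))) :
      f σ = ∑ i : Fin (n + 1), f (σ * Equiv.swap 0 i.succ) := by
    rw [hf]
    dsimp only
    rw [Θ.map_smul_eq_sum_map_update (by simpa using hm) L]
    refine Finset.sum_congr rfl fun i _ => ?_
    have hw : Function.update (fun k : Fin (n + 1) => v (σ k.succ)) i (v (σ 0)) =
        fun k => v (σ (Equiv.swap 0 i.succ k.succ)) := by
      funext k
      obtain rfl | h := eq_or_ne k i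
      · simp
      · have h1 : Equiv.swap 0 i.succ k.succ = k.succ :=
          Equiv.swap_apply_of_ne_of_ne (Fin.succ_ne_zero k) (by simpa using h)
        simp [h, h1]
    simp [hw]
  have hsum : ∑ σ, ((Equiv.Perm.sign σ : ℤ) : ℂ) * f σ =
      -((n + 1 : ℂ) * ∑ σ, ((Equiv.Perm.sign σ : ℤ) : ℂ) * f σ) := by
    conv_lhs => enter [2, σ]; rw [hstep, Finset.mul_sum]
    rw [Finset.sum_comm]
    simp_rw [Fin.sum_sign_mul_swap f (Fin.succ_ne_zero _).symm]
    simp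
  have hn : (n + 2 : ℂ) ≠ 0 := by exact_mod_cast (by omega : n + 2 ≠ 0)
  refine (mul_eq_zero.mp (?_ : (n + 2 : ℂ) * _ = 0)).resolve_left hn
  linear_combination hsum

theorem AlternatingMap.sum_sign_mul_apply_mul [FiniteDimensional ℂ V]
    (hm : Module.finrank ℂ V = n + 1) (Θ : V [⋀^Fin (n + 1)]→ₗ[ℂ] ℂ) (L : V → V →ₗ[ℂ] ℂ)
    (X : V) (v : Fin (n + 2) → V) :
    ∑ σ : Equiv.Perm (Fin (n + 2)),
        ((Equiv.Perm.sign σ : ℤ) : ℂ) * (L (v (σ 0)) X * Θ fun i => v (σ i.succ)) =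
      (n + 1 : ℂ) * ∑ σ : Equiv.Perm (Fin (n + 2)), ((Equiv.Perm.sign σ : ℤ) : ℂ) *
        (L (v (σ 0)) (v (σ 1)) * Θ (Fin.cons X fun i => v (σ i.succ.succ))) := by
  set f : Equiv.Perm (Fin (n + 2)) → ℂ := fun σ =>
    L (v (σ 0)) (v (σ 1)) * Θ (Fin.cons X fun i => v (σ i.succ.succ)) with hf
  have hterm (i : Fin (n + 1)) : ∑ σ : Equiv.Perm (Fin (n + 2)), ((Equiv.Perm.sign σ : ℤ) : ℂ) *
      (L (v (σ 0)) (v (σ i.succ)) * Θ (Function.update (fun k => v (σ k.succ)) i X)) =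
      ∑ σ, ((Equiv.Perm.sign σ : ℤ) : ℂ) * f σ := by
    have hcons (σ : Equiv.Perm (Fin (n + 2))) :
        Function.update (fun k : Fin (n + 1) => v (σ k.succ)) 0 X =
          Fin.cons X fun k => v (σ k.succ.succ) := by
      ext k
      cases k using Fin.cases <;> simp
    obtain rfl | hi := eq_or_ne i 0
    · simp [hf, hcons]
    have h1 : (1 : Fin (n + 2)) ≠ i.succ := fun h =>
      hi (Fin.succ_injective _ (by rw [← h, Fin.succ_zero_eq_one]))
    rw [← neg_neg (∑ σ, ((Equiv.Perm.sign σ : ℤ) : ℂ) * f σ), ← Fin.sum_sign_mul_swap f h1,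
      ← Finset.sum_neg_distrib]
    refine Finset.sum_congr rfl fun σ _ => ?_
    have h0 : Equiv.swap 1 i.succ 0 = 0 :=
      Equiv.swap_apply_of_ne_of_ne (by simp) (Fin.succ_ne_zero i).symm
    have hswap : Function.update (fun k : Fin (n + 1) => v (σ k.succ)) i X =
        (Fin.cons X fun k => v (σ (Equiv.swap 1 i.succ k.succ.succ)) : Fin (n + 1) → V) ∘
          Equiv.swap 0 i := by
      have := hcons (σ * Equiv.swap 1 i.succ)
      simp only [Equiv.Perm.mul_apply] at this
      rw [← this]
      ext k
      have hs : (Equiv.swap 0 i k).succ = Equiv.swap 1 i.succ k.succ := by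
        rw [← Fin.succ_zero_eq_one, (Fin.succ_injective _).swap_apply]
      by_cases h : k = i
      · simp [h]
      · have : Equiv.swap 0 i k ≠ 0 := by
          rw [Ne, Equiv.swap_apply_eq_iff]
          simpa using h
        rw [Function.comp_apply, Function.update_of_ne h, Function.update_of_ne this, hs,
          Equiv.swap_apply_self]
    rw [hswap, Θ.map_swap _ hi.symm]
    simp only [hf, Equiv.Perm.mul_apply, h0, Equiv.swap_apply_left, mul_neg]
  have hexp (σ : Equiv.Perm (Fin (n + 2))) := Θ.map_smul_eq_sum_map_update (by simpa using hm)
    (L (v (σ 0))) (fun i => v (σ i.succ)) X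
  conv_lhs => enter [2, σ]; rw [hexp, Finset.mul_sum]
  rw [Finset.sum_comm]
  simp_rw [hterm]
  simp [hf]

end

/-- On a complex vector space of complex dimension `m = n + 1`, for a real
alternating bilinear form `F` of type `(1,1)`, a `ℂ`-multilinear alternating
`m`-form `Θ` and any vector `X`, one has `(ι_X F) ∧ Θ + F ∧ (ι_X Θ) = 0`. -/
theorem stmt14 {V : Type*} [AddCommGroup V] [Module ℂ V] [FiniteDimensional ℂ V]
    {n : ℕ} (hm : Module.finrank ℂ V = n + 1)
    (Θ : AlternatingMap ℂ V ℂ (Fin (n + 1)))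
    (F : V →ₗ[ℝ] V →ₗ[ℝ] ℝ) (halt : ∀ x y : V, F x y = - F y x)
    (h11 : ∀ x y : V, F ((Complex.I : ℂ) • x) ((Complex.I : ℂ) • y) = F x y)
    (X : V) :
    ∀ v : Fin (n + 2) → V,
      rwedge (fun w : Fin 1 → V => ((F X (w 0) : ℝ) : ℂ))
          (fun w : Fin (n + 1) → V => Θ w) (fun i => v (Fin.cast (by omega) i))
        + rwedge (fun w : Fin 2 → V => ((F (w 0) (w 1) : ℝ) : ℂ))
          (fun w : Fin n → V => Θ (Fin.cons X w)) (fun i => v (Fin.cast (by omega) i))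
        = 0 := by
  intro v
  let L : V → V →ₗ[ℂ] ℂ := fun y => Module.Dual.extendRCLike (𝕜 := ℂ) (F.flip y)
  have hL (x y : V) : L y x = F x y - Complex.I * F (Complex.I • x) y := by
    simp [L, Module.Dual.extendRCLike_apply]
  have hF (x y : V) : (F x y : ℂ) = (L y x - L x y) / 2 := by
    have h1 : F (Complex.I • x) y = F (Complex.I • y) x := by
      rw [← h11, smul_smul, Complex.I_mul_I, neg_one_smul, map_neg, LinearMap.neg_apply, halt,
        neg_neg]
    rw [hL, hL, h1, halt y x]
    push_cast
    ring
  have hP := Θ.sum_sign_mul_apply_mul hm L X v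
  have hR := Θ.sum_sign_mul_linear_mul_eq_zero hm (L X) v
  have hQ := Fin.sum_sign_mul_swap (fun σ : Equiv.Perm (Fin (n + 2)) =>
    L (v (σ 0)) (v (σ 1)) * Θ (Fin.cons X fun i => v (σ i.succ.succ))) (i := 0) (j := 1) (by simp)
  have hs (i : Fin n) : Equiv.swap 0 1 i.succ.succ = i.succ.succ :=
    Equiv.swap_apply_of_ne_of_ne (Fin.succ_ne_zero _) (by simp [Fin.ext_iff])
  simp only [Equiv.Perm.mul_apply, Equiv.swap_apply_left, Equiv.swap_apply_right, hs] at hQ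
  have e1 (i : Fin (n + 1)) (h : 1 + (n + 1) = n + 2) : Fin.cast h (Fin.natAdd 1 i) = i.succ := by
    ext; simp
  have e2 (i : Fin n) (h : 2 + n = n + 2) : Fin.cast h (Fin.natAdd 2 i) = i.succ.succ := by
    ext; simp
  have e3 (h : 1 + (n + 1) = n + 2) : Fin.cast h (Fin.castAdd (n + 1) 0) = 0 := rfl
  have e4 (h : 2 + n = n + 2) : Fin.cast h (Fin.castAdd n 0) = 0 := by ext; simp
  have e5 (h : 2 + n = n + 2) : Fin.cast h (Fin.castAdd n 1) = 1 := by ext; simp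
  rw [rwedge_cast, rwedge_cast]
  simp only [e1, e2, e3, e4, e5, hF, sub_div, sub_mul, mul_sub, Finset.sum_sub_distrib]
  simp only [div_mul_eq_mul_div, mul_div_assoc', ← Finset.sum_div]
  rw [hP, hR, hQ]
  have hn : (n + 1 : ℂ) ≠ 0 := by exact_mod_cast n.succ_ne_zero
  have hf : (n.factorial : ℂ) ≠ 0 := by exact_mod_cast n.factorial_ne_zero
  simp only [Nat.factorial_succ, Nat.factorial_zero]
  push_cast
  field_simp
  ring
end
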